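/- arXiv:2312.12489 — 2 statements merged into one kernel-verified Lean document; each statement's English description precedes it below -/
import Mathlib

section
/- Let f₁, …, fₙ : X → ℝ^d be feature maps with E[fᵢ] = 0 for every i, let α ∈ ℝⁿ satisfy Σᵢ αᵢ = 1, and set f = Σᵢ αᵢ fᵢ. Assume Cov(f) = I_d (the d×d identity matrix). Define g* : Y → ℝ^d by g*(y) = Σᵢ αᵢ μ_{fᵢ}(y). Then for every map g : Y → ℝ^d one has H(f, g) ≤ H(f, g*); that is, the linear ensemble of the conditional means of the individual features is an optimal classifier for the combined feature. -/
noncomputable section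

open Matrix BigOperators

variable {X Y : Type*} [Fintype X] [Fintype Y]

/-- Marginal distribution of `X` under the joint pmf `p`. -/
def PX (p : X × Y → ℝ) (x : X) : ℝ := ∑ y, p (x, y)

/-- Marginal distribution of `Y` under the joint pmf `p`. -/
def PY (p : X × Y → ℝ) (y : Y) : ℝ := ∑ x, p (x, y)

/-- Mean `E[f] = Σ_x P_X(x) f(x)` of a feature map. -/
def fmean {d : ℕ} (p : X × Y → ℝ) (f : X → Fin d → ℝ) : Fin d → ℝ :=
  ∑ x, PX p x • f x

/-- Covariance matrix `Cov(f) = Σ_x P_X(x) (f(x) − E[f])(f(x) − E[f])ᵀ`. -/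
def fcov {d : ℕ} (p : X × Y → ℝ) (f : X → Fin d → ℝ) : Matrix (Fin d) (Fin d) ℝ :=
  ∑ x, PX p x • vecMulVec (f x - fmean p f) (f x - fmean p f)

/-- Conditional mean `μ_f(y) = (1/P_Y(y)) Σ_x p(x,y) f(x)`. -/
def condMean {d : ℕ} (p : X × Y → ℝ) (f : X → Fin d → ℝ) (y : Y) : Fin d → ℝ :=
  (PY p y)⁻¹ • ∑ x, p (x, y) • f x

/-- Mean `E[g] = Σ_y P_Y(y) g(y)` of a classifier map. -/
def gmean {d : ℕ} (p : X × Y → ℝ) (g : Y → Fin d → ℝ) : Fin d → ℝ :=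
  ∑ y, PY p y • g y

/-- Covariance matrix `Cov(g) = Σ_y P_Y(y) (g(y) − E[g])(g(y) − E[g])ᵀ`. -/
def gcov {d : ℕ} (p : X × Y → ℝ) (g : Y → Fin d → ℝ) : Matrix (Fin d) (Fin d) ℝ :=
  ∑ y, PY p y • vecMulVec (g y - gmean p g) (g y - gmean p g)

/-- H-score `H(f,g) = Σ_{x,y} p(x,y) f(x)ᵀ g(y) − (1/2) tr(Cov(f)·Cov(g))`. -/
def Hscore {d : ℕ} (p : X × Y → ℝ) (f : X → Fin d → ℝ) (g : Y → Fin d → ℝ) : ℝ :=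
  (∑ x, ∑ y, p (x, y) * (f x ⬝ᵥ g y)) - (1 / 2) * (fcov p f * gcov p g).trace

/-- MCR loss `L(f,g) = Σ_x P_X(x) Σ_y [P_Y(y)(1 + f(x)ᵀ g(y)) − p(x,y)/P_X(x)]² / P_Y(y)`. -/
def Lloss {d : ℕ} (p : X × Y → ℝ) (f : X → Fin d → ℝ) (g : Y → Fin d → ℝ) : ℝ :=
  ∑ x, PX p x * ∑ y, (PY p y * (1 + f x ⬝ᵥ g y) - p (x, y) / PX p x) ^ 2 / PY p y

lemma gmean_eq_fmean_of_forall {X Y : Type*} [Fintype X] [Fintype Y] {d : ℕ}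
    {p : X × Y → ℝ} {f : X → Fin d → ℝ} {g : Y → Fin d → ℝ}
    (h : ∀ y, PY p y • g y = ∑ x, p (x, y) • f x) : gmean p g = fmean p f := by
  simp only [gmean, fmean, PX, h, Finset.sum_smul]
  exact Finset.sum_comm

lemma PY_smul_condMean {X Y : Type*} [Fintype X] [Fintype Y] {d : ℕ}
    {p : X × Y → ℝ} (f : X → Fin d → ℝ) {y : Y} (hy : PY p y ≠ 0) :
    PY p y • condMean p f y = ∑ x, p (x, y) • f x :=
  smul_inv_smul₀ hy _

lemma sum_mul_dotProduct_eq {X Y : Type*} [Fintype X] [Fintype Y] {d : ℕ}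
    {p : X × Y → ℝ} {f : X → Fin d → ℝ} {g₀ : Y → Fin d → ℝ}
    (h : ∀ y, PY p y • g₀ y = ∑ x, p (x, y) • f x) (g : Y → Fin d → ℝ) :
    ∑ x, ∑ y, p (x, y) * (f x ⬝ᵥ g y) = ∑ y, PY p y * (g₀ y ⬝ᵥ g y) := by
  rw [Finset.sum_comm]
  refine Finset.sum_congr rfl fun y _ => ?_
  rw [← smul_eq_mul (PY p y), ← smul_dotProduct, h, sum_dotProduct]
  simp [smul_dotProduct]

lemma trace_gcov {X Y : Type*} [Fintype X] [Fintype Y] {d : ℕ}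
    (p : X × Y → ℝ) (g : Y → Fin d → ℝ) :
    (gcov p g).trace = ∑ y, PY p y * ((g y - gmean p g) ⬝ᵥ (g y - gmean p g)) := by
  simp [gcov, trace_sum, trace_smul, trace_vecMulVec]

/-- For a centred feature with identity covariance, the H-score of `g` is a quadratic function of
the centred classifier. -/
lemma Hscore_eq_sum {X Y : Type*} [Fintype X] [Fintype Y] {d : ℕ}
    {p : X × Y → ℝ} {f : X → Fin d → ℝ} {g₀ : Y → Fin d → ℝ}
    (h : ∀ y, PY p y • g₀ y = ∑ x, p (x, y) • f x) (hmean : gmean p g₀ = 0)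
    (hcov : fcov p f = 1) (g : Y → Fin d → ℝ) :
    Hscore p f g = ∑ y, PY p y * (g₀ y ⬝ᵥ (g y - gmean p g)
      - 1 / 2 * ((g y - gmean p g) ⬝ᵥ (g y - gmean p g))) := by
  have hzero : ∑ y, PY p y * (g₀ y ⬝ᵥ gmean p g) = 0 := by
    simp only [← smul_eq_mul (PY p _), ← smul_dotProduct]
    rw [← sum_dotProduct, ← gmean, hmean, zero_dotProduct]
  rw [Hscore, hcov, one_mul, trace_gcov, sum_mul_dotProduct_eq h, Finset.mul_sum]
  simp only [mul_sub, Finset.sum_sub_distrib, dotProduct_sub (g₀ _), hzero, sub_zero]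
  simp only [mul_left_comm]

lemma dotProduct_sub_half_le {d : ℕ} (a c : Fin d → ℝ) :
    a ⬝ᵥ c - 1 / 2 * (c ⬝ᵥ c) ≤ a ⬝ᵥ a - 1 / 2 * (a ⬝ᵥ a) := by
  have h : 0 ≤ (a - c) ⬝ᵥ (a - c) := Finset.sum_nonneg fun i _ => mul_self_nonneg _
  rw [sub_dotProduct, dotProduct_sub, dotProduct_sub, dotProduct_comm c a] at h
  linarith

/-- for a normalized linear ensemble `f = Σᵢ αᵢ fᵢ` of zero-mean
features with `Cov(f) = I`, the ensemble of conditional means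
`g*(y) = Σᵢ αᵢ μ_{fᵢ}(y)` is an optimal classifier for the H-score. -/
theorem hscore_ensemble_optimal_classifier
    {X Y : Type*} [Fintype X] [Fintype Y] [Nonempty X] [Nonempty Y] {d : ℕ}
    (p : X × Y → ℝ)
    (hp_nonneg : ∀ x y, 0 ≤ p (x, y))
    (hp_sum : ∑ x, ∑ y, p (x, y) = 1)
    (hPX_pos : ∀ x, 0 < PX p x) (hPY_pos : ∀ y, 0 < PY p y)
    (n : ℕ) (F : Fin n → X → Fin d → ℝ)
    (hF_mean : ∀ i, fmean p (F i) = 0)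
    (α : Fin n → ℝ) (hα : ∑ i, α i = 1)
    (f : X → Fin d → ℝ) (hf : ∀ x, f x = ∑ i, α i • F i x)
    (hf_cov : fcov p f = (1 : Matrix (Fin d) (Fin d) ℝ))
    (gstar : Y → Fin d → ℝ)
    (hgstar : ∀ y, gstar y = ∑ i, α i • condMean p (F i) y)
    (g : Y → Fin d → ℝ) :
    Hscore p f g ≤ Hscore p f gstar := by
  have h : ∀ y, PY p y • gstar y = ∑ x, p (x, y) • f x := by
    intro y
    simp only [hgstar, hf, Finset.smul_sum]
    rw [Finset.sum_comm]
    refine Finset.sum_congr rfl fun i _ => ?_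
    rw [smul_comm, PY_smul_condMean _ (hPY_pos y).ne', Finset.smul_sum]
    exact Finset.sum_congr rfl fun x _ => smul_comm _ _ _
  have hfmean : fmean p f = 0 := by
    have hsum : fmean p f = ∑ i, α i • fmean p (F i) := by
      simp only [fmean, hf, Finset.smul_sum]
      rw [Finset.sum_comm]
      exact Finset.sum_congr rfl fun i _ => Finset.sum_congr rfl fun x _ => smul_comm _ _ _
    simp [hsum, hF_mean]
  have hmean : gmean p gstar = 0 := (gmean_eq_fmean_of_forall h).trans hfmean
  rw [Hscore_eq_sum h hmean hf_cov, Hscore_eq_sum h hmean hf_cov gstar, hmean]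
  simp only [sub_zero (gstar _)]
  exact Finset.sum_le_sum fun y _ =>
    mul_le_mul_of_nonneg_left (dotProduct_sub_half_le _ _) (hPY_pos y).le

end
end

section
/- Suppose E[f] = 0. Then for every map g : Y → ℝ^d, L(f, g) = C₀ − 1 − 2 H(f, g) + E[g]ᵀ Cov(f) E[g], where C₀ = Σ_{x,y} p(x,y)² / (P_X(x) P_Y(y)) depends only on the joint distribution p. In particular, if in addition E[g] = 0, then L(f, g) = C₀ − 1 − 2 H(f, g). -/
noncomputable section

open Matrix BigOperators

variable {X Y : Type*} [Fintype X] [Fintype Y]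

/-- The quadratic form of the covariance matrix of a zero-mean feature map. -/
theorem dotProduct_fcov_mulVec_of_fmean_eq_zero {X Y : Type*} [Fintype X] [Fintype Y] {d : ℕ}
    (p : X × Y → ℝ) (f : X → Fin d → ℝ) (hf : fmean p f = 0) (v : Fin d → ℝ) :
    v ⬝ᵥ (fcov p f *ᵥ v) = ∑ x, PX p x * (f x ⬝ᵥ v) ^ 2 := by
  simp only [fcov, hf, sub_zero, sum_mulVec, dotProduct_sum, smul_mulVec, vecMulVec_mulVec,
    dotProduct_smul, smul_eq_mul, op_smul_eq_smul]
  refine Finset.sum_congr rfl fun x _ => ?_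
  rw [dotProduct_comm v (f x)]
  ring

/-- The trace of a matrix times a covariance matrix averages the quadratic form. -/
theorem trace_mul_gcov {X Y : Type*} [Fintype X] [Fintype Y] {d : ℕ}
    (p : X × Y → ℝ) (A : Matrix (Fin d) (Fin d) ℝ) (g : Y → Fin d → ℝ) :
    (A * gcov p g).trace =
      ∑ y, PY p y * ((g y - gmean p g) ⬝ᵥ (A *ᵥ (g y - gmean p g))) := by
  simp only [gcov, Matrix.mul_sum, trace_sum, Matrix.mul_smul, trace_smul, smul_eq_mul,
    mul_vecMulVec, trace_vecMulVec]
  refine Finset.sum_congr rfl fun y _ => ?_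
  rw [dotProduct_comm]

theorem sum_PY_mul_dotProduct {X Y : Type*} [Fintype X] [Fintype Y] {d : ℕ}
    (p : X × Y → ℝ) (g : Y → Fin d → ℝ) (v : Fin d → ℝ) :
    ∑ y, PY p y * (v ⬝ᵥ g y) = v ⬝ᵥ gmean p g := by
  simp only [gmean, dotProduct_sum, dotProduct_smul, smul_eq_mul]

theorem sum_PX_mul_dotProduct {X Y : Type*} [Fintype X] [Fintype Y] {d : ℕ}
    (p : X × Y → ℝ) (f : X → Fin d → ℝ) (v : Fin d → ℝ) :
    ∑ x, PX p x * (f x ⬝ᵥ v) = fmean p f ⬝ᵥ v := by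
  simp only [fmean, sum_dotProduct, smul_dotProduct, smul_eq_mul]

/-- For a zero-mean feature map, `tr(Cov(f)·Cov(g))` is the second moment of `f(x)ᵀ g(y)` under
the product of the marginals, minus `E[g]ᵀ Cov(f) E[g]`. -/
theorem trace_fcov_mul_gcov_of_fmean_eq_zero {X Y : Type*} [Fintype X] [Fintype Y] {d : ℕ}
    (p : X × Y → ℝ) (hPY : ∑ y, PY p y = 1) (f : X → Fin d → ℝ) (hf : fmean p f = 0)
    (g : Y → Fin d → ℝ) :
    (fcov p f * gcov p g).trace =
      (∑ x, ∑ y, PX p x * PY p y * (f x ⬝ᵥ g y) ^ 2) -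
        gmean p g ⬝ᵥ (fcov p f *ᵥ gmean p g) := by
  simp only [trace_mul_gcov, dotProduct_fcov_mulVec_of_fmean_eq_zero p f hf, Finset.mul_sum]
  rw [Finset.sum_comm, ← Finset.sum_sub_distrib]
  refine Finset.sum_congr rfl fun x _ => ?_
  have hexp : ∀ y, PY p y * (PX p x * (f x ⬝ᵥ (g y - gmean p g)) ^ 2) =
      PX p x * PY p y * (f x ⬝ᵥ g y) ^ 2
        - 2 * PX p x * (f x ⬝ᵥ gmean p g) * (PY p y * (f x ⬝ᵥ g y))
        + PX p x * (f x ⬝ᵥ gmean p g) ^ 2 * PY p y := by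
    intro y
    rw [dotProduct_sub]
    ring
  simp only [hexp, Finset.sum_add_distrib, Finset.sum_sub_distrib, ← Finset.mul_sum,
    sum_PY_mul_dotProduct, hPY]
  ring

/-- for a zero-mean feature `f`, the MCR loss decomposes as
`L(f,g) = C₀ − 1 − 2 H(f,g) + E[g]ᵀ Cov(f) E[g]`, where
`C₀ = Σ_{x,y} p(x,y)²/(P_X(x) P_Y(y))`; in particular, if `E[g] = 0`, then
`L(f,g) = C₀ − 1 − 2 H(f,g)`. -/
theorem mcr_loss_hscore_decomposition
    {X Y : Type*} [Fintype X] [Fintype Y] [Nonempty X] [Nonempty Y] {d : ℕ}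
    (p : X × Y → ℝ)
    (hp_nonneg : ∀ x y, 0 ≤ p (x, y))
    (hp_sum : ∑ x, ∑ y, p (x, y) = 1)
    (hPX_pos : ∀ x, 0 < PX p x) (hPY_pos : ∀ y, 0 < PY p y)
    (f : X → Fin d → ℝ) (hf_mean : fmean p f = 0)
    (C₀ : ℝ) (hC₀ : C₀ = ∑ x, ∑ y, (p (x, y)) ^ 2 / (PX p x * PY p y)) :
    (∀ g : Y → Fin d → ℝ,
      Lloss p f g = C₀ - 1 - 2 * Hscore p f g +
        gmean p g ⬝ᵥ (fcov p f *ᵥ gmean p g)) ∧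
    (∀ g : Y → Fin d → ℝ, gmean p g = 0 →
      Lloss p f g = C₀ - 1 - 2 * Hscore p f g) := by
  have hPX_sum : ∑ x, PX p x = 1 := hp_sum
  have hPY_sum : ∑ y, PY p y = 1 := by
    simp only [PY]
    rw [Finset.sum_comm, hp_sum]
  have main : ∀ g : Y → Fin d → ℝ,
      Lloss p f g = C₀ - 1 - 2 * Hscore p f g +
        gmean p g ⬝ᵥ (fcov p f *ᵥ gmean p g) := by
    intro g
    have hexp : ∀ x y,
        PX p x * ((PY p y * (1 + f x ⬝ᵥ g y) - p (x, y) / PX p x) ^ 2 / PY p y) =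
          p (x, y) ^ 2 / (PX p x * PY p y) + PX p x * PY p y
            + 2 * (PX p x * (PY p y * (f x ⬝ᵥ g y)))
            + PX p x * PY p y * (f x ⬝ᵥ g y) ^ 2
            - 2 * p (x, y) - 2 * (p (x, y) * (f x ⬝ᵥ g y)) := by
      intro x y
      have hx := (hPX_pos x).ne'
      have hy := (hPY_pos y).ne'
      field_simp
      ring
    have hmarginals : ∑ x, ∑ y, PX p x * PY p y = 1 := by
      simp only [← Finset.mul_sum, hPY_sum, mul_one, hPX_sum]
    have hcross : ∑ x, ∑ y, PX p x * (PY p y * (f x ⬝ᵥ g y)) = 0 := by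
      simp only [← Finset.mul_sum, sum_PY_mul_dotProduct, sum_PX_mul_dotProduct, hf_mean,
        zero_dotProduct]
    have hL : Lloss p f g = C₀ + 1 + (∑ x, ∑ y, PX p x * PY p y * (f x ⬝ᵥ g y) ^ 2)
        - 2 - 2 * ∑ x, ∑ y, p (x, y) * (f x ⬝ᵥ g y) := by
      simp only [Lloss, Finset.mul_sum, hexp, Finset.sum_add_distrib, Finset.sum_sub_distrib]
      simp only [← Finset.mul_sum _ _ (2 : ℝ), hmarginals, hcross, hp_sum, ← hC₀]
      ring
    rw [hL, Hscore, trace_fcov_mul_gcov_of_fmean_eq_zero p hPY_sum f hf_mean g]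
    ring
  refine ⟨main, fun g hg => ?_⟩
  rw [main g, hg, zero_dotProduct, add_zero]

end
end
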